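/- arXiv:1907.12795 — 3 statements merged into one kernel-verified Lean document; each statement's English description precedes it below -/
import Mathlib

section
/- L² Bernstein–von Mises limit for the Poisson–gamma posterior variance under the true parameter: For all α, β > 0 and every θ > 0, the expectation under the n-fold product Poisson measure Poi(θ)^{⊗n} of |n·(α + S(x))/(n + β)² − θ|² converges to 0 as n → ∞. -/
open MeasureTheory ProbabilityTheory Filter

open scoped NNReal Nat

/-- The Stein–Chen identity `E[X f(X)] = r E[f(X + 1)]` for the Poisson distribution. -/
lemma hasSum_poisson_mul_natCast {r : ℝ} {f : ℕ → ℝ} {a : ℝ}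
    (h : HasSum (fun n : ℕ => Real.exp (-r) * r ^ n / n ! * f (n + 1)) a) :
    HasSum (fun n : ℕ => Real.exp (-r) * r ^ n / n ! * (n * f n)) (r * a) := by
  rw [← hasSum_nat_add_iff' 1]
  have hterm (n : ℕ) : Real.exp (-r) * r ^ (n + 1) / (n + 1)! * ((n + 1 : ℕ) * f (n + 1)) =
      r * (Real.exp (-r) * r ^ n / n ! * f (n + 1)) := by
    rw [Nat.factorial_succ]
    push_cast
    field_simp
    ring
  simpa only [hterm, Finset.sum_range_one, Nat.cast_zero, zero_mul, mul_zero, sub_zero]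
    using h.mul_left r

lemma hasSum_poisson_natCast (r : ℝ≥0) :
    HasSum (fun n : ℕ => Real.exp (-r) * r ^ n / n ! * (n : ℝ)) r := by
  simpa using hasSum_poisson_mul_natCast (f := fun _ => 1) (a := 1)
    (by simpa using hasSum_one_poissonMeasure r)

lemma hasSum_poisson_natCast_sq (r : ℝ≥0) :
    HasSum (fun n : ℕ => Real.exp (-r) * r ^ n / n ! * (n : ℝ) ^ 2) (r * (r + 1)) := by
  simpa [pow_two] using hasSum_poisson_mul_natCast (f := fun n => (n : ℝ))
    (by simpa [mul_add] using (hasSum_poisson_natCast r).add (hasSum_one_poissonMeasure r))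

lemma integral_natCast_poissonMeasure (r : ℝ≥0) :
    ∫ k : ℕ, (k : ℝ) ∂poissonMeasure r = r := by
  simpa [integral_poissonMeasure] using (hasSum_poisson_natCast r).tsum_eq

lemma memLp_two_natCast_poissonMeasure (r : ℝ≥0) :
    MemLp (fun k : ℕ => (k : ℝ)) 2 (poissonMeasure r) := by
  rw [memLp_two_iff_integrable_sq (by fun_prop), integrable_poissonMeasure_iff]
  simpa using (hasSum_poisson_natCast_sq r).summable

/-- Bias–variance decomposition of the mean squared deviation from a constant. -/
lemma integral_sub_const_sq {Ω : Type*} {_ : MeasurableSpace Ω} {μ : Measure Ω}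
    [IsProbabilityMeasure μ] {X : Ω → ℝ} (hX : MemLp X 2 μ) (t : ℝ) :
    ∫ ω, (X ω - t) ^ 2 ∂μ = Var[X; μ] + (∫ ω, X ω ∂μ - t) ^ 2 := by
  have h := variance_eq_sub (hX.sub (memLp_const t))
  have hv : Var[X - fun _ => t; μ] = Var[X; μ] := variance_sub_const hX.aestronglyMeasurable t
  have hm : ∫ ω, (X - fun _ : Ω => t) ω ∂μ = ∫ ω, X ω ∂μ - t := by
    simp [integral_sub (hX.integrable (by norm_num)) (integrable_const t)]
  rw [hv, hm] at h
  rw [h]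
  simp

lemma memLp_two_sum_pi_poissonMeasure (r : ℝ≥0) (n : ℕ) :
    MemLp (fun x : Fin n → ℕ => ∑ i, (x i : ℝ)) 2 (Measure.pi fun _ => poissonMeasure r) :=
  memLp_finsetSum _ fun i _ => (memLp_two_natCast_poissonMeasure r).comp_measurePreserving
    (measurePreserving_eval (fun _ : Fin n => poissonMeasure r) i)

lemma integral_sum_pi_poissonMeasure (r : ℝ≥0) (n : ℕ) :
    ∫ x : Fin n → ℕ, ∑ i, (x i : ℝ) ∂(Measure.pi fun _ => poissonMeasure r) = n * r := by
  have hint := (memLp_two_natCast_poissonMeasure r).integrable (by norm_num)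
  rw [integral_finsetSum _ fun i _ =>
    integrable_comp_eval (μ := fun _ : Fin n => poissonMeasure r) hint]
  have h (i : Fin n) : ∫ x : Fin n → ℕ, (x i : ℝ) ∂(Measure.pi fun _ => poissonMeasure r) = r :=
    (integral_comp_eval (μ := fun _ : Fin n => poissonMeasure r)
      hint.aestronglyMeasurable).trans (integral_natCast_poissonMeasure r)
  simp [h]

lemma variance_natCast_poissonMeasure (r : ℝ≥0) :
    Var[fun k : ℕ => (k : ℝ); poissonMeasure r] = r := by
  have h : ∫ k : ℕ, (k : ℝ) ^ 2 ∂poissonMeasure r = r * (r + 1) := by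
    simpa [integral_poissonMeasure] using (hasSum_poisson_natCast_sq r).tsum_eq
  rw [variance_eq_sub (memLp_two_natCast_poissonMeasure r), integral_natCast_poissonMeasure]
  simp only [Pi.pow_apply, h]
  ring

lemma variance_sum_pi_poissonMeasure (r : ℝ≥0) (n : ℕ) :
    Var[fun x : Fin n → ℕ => ∑ i, (x i : ℝ); Measure.pi fun _ => poissonMeasure r] = n * r := by
  have h := variance_sum_pi (μ := fun _ : Fin n => poissonMeasure r)
    (X := fun _ k => (k : ℝ)) fun _ => memLp_two_natCast_poissonMeasure r
  simp only [variance_natCast_poissonMeasure] at h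
  convert h using 1
  · congr 1
    ext x
    simp
  · simp

/-- L² Bernstein–von Mises limit for the Poisson–gamma posterior variance under the true
parameter: `E_{Poi(θ)^{⊗n}}[|n·(α + S(x))/(n + β)² − θ|²] → 0` as `n → ∞`. -/
theorem poisson_gamma_bvm_L2_true
    (α β : ℝ) (hα : 0 < α) (hβ : 0 < β) (θ : ℝ) (hθ : 0 < θ) :
    Tendsto (fun n : ℕ =>
        ∫ x : Fin n → ℕ,
          |(n : ℝ) * ((α + ∑ i, (x i : ℝ)) / ((n : ℝ) + β) ^ 2) - θ| ^ 2
          ∂(Measure.pi fun _ : Fin n => poissonMeasure θ.toNNReal))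
      atTop (nhds 0) := by
  have hpos (n : ℕ) : (n : ℝ) + β ≠ 0 := by positivity
  have mse (n : ℕ) :
      ∫ x : Fin n → ℕ, |(n : ℝ) * ((α + ∑ i, (x i : ℝ)) / ((n : ℝ) + β) ^ 2) - θ| ^ 2
          ∂(Measure.pi fun _ : Fin n => poissonMeasure θ.toNNReal) =
        (n / (n + β) : ℝ) ^ 3 * (n + β : ℝ)⁻¹ * θ +
          ((n / (n + β) : ℝ) * (n + β : ℝ)⁻¹ * α + (n / (n + β) : ℝ) ^ 2 * θ - θ) ^ 2 := by
    set c : ℝ := n / (n + β) ^ 2 with hc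
    have hcongr (x : Fin n → ℕ) :
        |(n : ℝ) * ((α + ∑ i, (x i : ℝ)) / ((n : ℝ) + β) ^ 2) - θ| ^ 2 =
          (c * ∑ i, (x i : ℝ) - (θ - c * α)) ^ 2 := by
      rw [sq_abs, hc]
      ring
    simp_rw [hcongr]
    rw [integral_sub_const_sq ((memLp_two_sum_pi_poissonMeasure _ n).const_mul c),
      variance_const_mul, integral_const_mul, variance_sum_pi_poissonMeasure,
      integral_sum_pi_poissonMeasure, Real.coe_toNNReal _ hθ.le, hc]
    have := hpos n
    field_simp
    ring
  simp_rw [mse]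
  have hratio : Tendsto (fun n : ℕ => (n / (n + β) : ℝ)) atTop (nhds 1) :=
    tendsto_natCast_div_add_atTop β
  have hinv : Tendsto (fun n : ℕ => (n + β : ℝ)⁻¹) atTop (nhds 0) :=
    tendsto_inv_atTop_zero.comp
      (tendsto_atTop_add_const_right _ β tendsto_natCast_atTop_atTop)
  have hvar := ((hratio.pow 3).mul hinv).mul_const θ
  have hbias := ((((hratio.mul hinv).mul_const α).add
    ((hratio.pow 2).mul_const θ)).sub_const θ).pow 2
  simpa using hvar.add hbias
end

section
/- Expected posterior variance for the normal model with normal-inverse-gamma prior: For all hyperparameters μ₀ ∈ ℝ, λ > 0, β > 0, α > 1 and all n ≥ 1, the expectation of u_n²(x) = (2β + Σᵢ(xᵢ − x̄)² + (n/(λ·n_λ))·(x̄ − μ₀)²) / (n_λ·(n + 2α − 2)) under the joint normal-inverse-gamma sampling model (i.e. under the prior predictive of x) equals β / (n_λ·(α − 1)), where n_λ = n + λ^{−1}. -/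
open MeasureTheory ProbabilityTheory

/-- Lebesgue integrals of nonnegative real functions against a mixture of measures. -/
theorem lintegral_ofReal_bind_congr {Ω Ω' : Type*} [MeasurableSpace Ω] [MeasurableSpace Ω']
    {m : Measure Ω} {κ : Ω → Measure Ω'} (hκ : Measurable κ) {f : Ω' → ℝ} (hf : Measurable f)
    {g : Ω → ℝ}
    (h : ∀ᵐ a ∂m, ∫⁻ x, ENNReal.ofReal (f x) ∂(κ a) = ENNReal.ofReal (g a)) :
    ∫⁻ x, ENNReal.ofReal (f x) ∂(m.bind κ) = ∫⁻ a, ENNReal.ofReal (g a) ∂m := by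
  rw [Measure.lintegral_bind hκ.aemeasurable hf.ennreal_ofReal.aemeasurable]
  exact lintegral_congr_ae h

theorem measurable_pi_gaussianReal {ι : Type*} [Fintype ι] :
    Measurable (fun p : ℝ × NNReal => Measure.pi fun _ : ι => gaussianReal p.1 p.2) := by
  refine Measurable.measure_of_isPiSystem_of_isProbabilityMeasure
    generateFrom_pi.symm isPiSystem_pi ?_
  rintro _ ⟨s, hs, rfl⟩
  simp only [Set.mem_univ, Set.mem_ofPred_eq, Set.mem_pi, true_implies] at hs
  simp_rw [Measure.pi_pi]
  exact Finset.measurable_fun_prod _ fun i _ =>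
    (Measure.measurable_coe (hs i)).comp measurable_gaussianReal

theorem measurable_gaussianReal_bind_pi {ι : Type*} [Fintype ι] (μ₀ l : ℝ) :
    Measurable (fun s2 : ℝ => (gaussianReal μ₀ (l * s2).toNNReal).bind (fun μ =>
      Measure.pi fun _ : ι => gaussianReal μ s2.toNNReal)) := by
  have hκ : Measurable (fun p : ℝ × ℝ => Measure.pi fun _ : ι =>
      gaussianReal p.2 p.1.toNNReal) :=
    measurable_pi_gaussianReal.comp (measurable_snd.prodMk measurable_fst.real_toNNReal)
  let η : Kernel ℝ ℝ := ⟨fun s2 => gaussianReal μ₀ (l * s2).toNNReal,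
    measurable_gaussianReal.comp
      (measurable_const.prodMk (measurable_id.const_mul l).real_toNNReal)⟩
  have : IsMarkovKernel η := ⟨fun s2 => by
    change IsProbabilityMeasure (gaussianReal μ₀ (l * s2).toNNReal); infer_instance⟩
  refine Measure.measurable_of_measurable_coe _ fun s hs => ?_
  have hbind (s2 : ℝ) : (gaussianReal μ₀ (l * s2).toNNReal).bind (fun μ =>
      Measure.pi fun _ : ι => gaussianReal μ s2.toNNReal) s
      = ∫⁻ μ, (Measure.pi fun _ : ι => gaussianReal μ s2.toNNReal) s ∂(η s2) :=
    Measure.bind_apply hs (hκ.comp measurable_prodMk_left).aemeasurable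
  simp_rw [hbind]
  exact Measurable.lintegral_kernel_prod_right' (κ := η)
    ((Measure.measurable_coe hs).comp hκ)

theorem memLp_sub_const_gaussianReal (μ c : ℝ) (v : NNReal) :
    MemLp (fun x => x - c) 2 (gaussianReal μ v) :=
  (memLp_id_gaussianReal' 2 (by simp)).sub (memLp_const c)

theorem integral_sub_const_gaussianReal (μ c : ℝ) (v : NNReal) :
    ∫ x, (x - c) ∂gaussianReal μ v = μ - c := by
  have hid : Integrable (fun x : ℝ => x) (gaussianReal μ v) :=
    (memLp_id_gaussianReal' 2 (by simp)).integrable one_le_two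
  rw [integral_sub hid (integrable_const c)]
  simp

theorem variance_sub_const_gaussianReal (μ c : ℝ) (v : NNReal) :
    Var[fun x => x - c; gaussianReal μ v] = v := by
  rw [variance_sub_const (by fun_prop), variance_fun_id_gaussianReal]

theorem integral_sub_const_sq_gaussianReal (μ c : ℝ) (v : NNReal) :
    ∫ x, (x - c) ^ 2 ∂gaussianReal μ v = v + (μ - c) ^ 2 := by
  have h := variance_eq_sub (memLp_sub_const_gaussianReal μ c v)
  rw [variance_sub_const_gaussianReal, integral_sub_const_gaussianReal] at h
  simp only [Pi.pow_apply] at h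
  linarith

theorem memLp_sum_sub_const_pi_gaussianReal {ι : Type*} [Fintype ι] (μ c : ℝ) (v : NNReal) :
    MemLp (fun x : ι → ℝ => ∑ i, (x i - c)) 2 (Measure.pi fun _ : ι => gaussianReal μ v) :=
  memLp_finsetSum _ fun i _ => (memLp_sub_const_gaussianReal μ c v).comp_measurePreserving
    (measurePreserving_eval (fun _ : ι => gaussianReal μ v) i)

theorem integral_sum_sub_const_sq_pi_gaussianReal {ι : Type*} [Fintype ι] (μ c : ℝ)
    (v : NNReal) :
    ∫ x : ι → ℝ, (∑ i, (x i - c)) ^ 2 ∂(Measure.pi fun _ : ι => gaussianReal μ v)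
      = Fintype.card ι * v + (Fintype.card ι * (μ - c)) ^ 2 := by
  have h := variance_eq_sub (memLp_sum_sub_const_pi_gaussianReal (ι := ι) μ c v)
  have hvar := variance_sum_pi (ι := ι) fun _ => memLp_sub_const_gaussianReal μ c v
  have hmean : ∫ x : ι → ℝ, ∑ i, (x i - c) ∂(Measure.pi fun _ : ι => gaussianReal μ v)
      = Fintype.card ι * (μ - c) := by
    rw [integral_finsetSum _ fun i _ => integrable_comp_eval
      (μ := fun _ : ι => gaussianReal μ v) (i := i) (f := fun y : ℝ => y - c)
      ((memLp_sub_const_gaussianReal μ c v).integrable one_le_two)]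
    simp_rw [fun i : ι => integral_comp_eval (μ := fun _ : ι => gaussianReal μ v) (i := i)
      (memLp_sub_const_gaussianReal μ c v).aestronglyMeasurable,
      integral_sub_const_gaussianReal]
    rw [Finset.sum_const, Finset.card_univ, nsmul_eq_mul]
  have hfun : (∑ i : ι, fun ω : ι → ℝ => ω i - c) = fun x : ι → ℝ => ∑ i, (x i - c) := by
    ext x; simp
  rw [hfun] at hvar
  simp only [variance_sub_const_gaussianReal, Finset.sum_const, Finset.card_univ,
    nsmul_eq_mul] at hvar
  rw [hvar, hmean] at h
  simp only [Pi.pow_apply] at h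
  linarith

/-- Expectation of a quadratic form in the deviations from a fixed centre `c`. -/
theorem lintegral_quadratic_pi_gaussianReal {ι : Type*} [Fintype ι] (μ c : ℝ) (v : NNReal)
    (a p q : ℝ) (h0 : ∀ x : ι → ℝ, 0 ≤ a + p * ∑ i, (x i - c) ^ 2 + q * (∑ i, (x i - c)) ^ 2) :
    ∫⁻ x : ι → ℝ, ENNReal.ofReal (a + p * ∑ i, (x i - c) ^ 2 + q * (∑ i, (x i - c)) ^ 2)
        ∂(Measure.pi fun _ : ι => gaussianReal μ v)
      = ENNReal.ofReal (a + p * (Fintype.card ι * (v + (μ - c) ^ 2))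
        + q * (Fintype.card ι * v + (Fintype.card ι * (μ - c)) ^ 2)) := by
  have hsq (i : ι) : Integrable (fun x : ι → ℝ => (x i - c) ^ 2)
      (Measure.pi fun _ : ι => gaussianReal μ v) :=
    integrable_comp_eval (μ := fun _ : ι => gaussianReal μ v) (i := i)
      (f := fun y : ℝ => (y - c) ^ 2)
      (memLp_sub_const_gaussianReal μ c v).integrable_sq
  have hsum : Integrable (fun x : ι → ℝ => p * ∑ i, (x i - c) ^ 2)
      (Measure.pi fun _ : ι => gaussianReal μ v) :=
    (integrable_finsetSum _ fun i _ => hsq i).const_mul p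
  have hS : Integrable (fun x : ι → ℝ => q * (∑ i, (x i - c)) ^ 2)
      (Measure.pi fun _ : ι => gaussianReal μ v) :=
    (memLp_sum_sub_const_pi_gaussianReal μ c v).integrable_sq.const_mul q
  have hadd : Integrable (fun x : ι → ℝ => a + p * ∑ i, (x i - c) ^ 2)
      (Measure.pi fun _ : ι => gaussianReal μ v) :=
    (integrable_const a).add hsum
  rw [← ofReal_integral_eq_lintegral_ofReal (by exact hadd.add hS) (ae_of_all _ h0)]
  congr 1
  rw [integral_add hadd hS, integral_add (integrable_const a) hsum, integral_const_mul, integral_const_mul,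
    integral_sum_sub_const_sq_pi_gaussianReal, integral_finsetSum _ fun i _ => hsq i]
  simp_rw [fun i : ι => integral_comp_eval (μ := fun _ : ι => gaussianReal μ v) (i := i)
    (f := fun y : ℝ => (y - c) ^ 2)
    (memLp_sub_const_gaussianReal μ c v).integrable_sq.aestronglyMeasurable,
    integral_sub_const_sq_gaussianReal]
  rw [Finset.sum_const, Finset.card_univ, nsmul_eq_mul, integral_const, probReal_univ, one_smul]

theorem lintegral_quadratic_gaussianReal (c : ℝ) (v : NNReal) (a b : ℝ) (ha : 0 ≤ a)
    (hb : 0 ≤ b) :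
    ∫⁻ μ, ENNReal.ofReal (a + b * (μ - c) ^ 2) ∂(gaussianReal c v)
      = ENNReal.ofReal (a + b * v) := by
  have hsq := (memLp_sub_const_gaussianReal c c v).integrable_sq.const_mul b
  have hadd : Integrable (fun x => a + b * (x - c) ^ 2) (gaussianReal c v) :=
    (integrable_const a).add hsq
  rw [← ofReal_integral_eq_lintegral_ofReal hadd
    (ae_of_all _ fun x => by simp only [Pi.zero_apply]; positivity)]
  congr 1
  rw [integral_add (integrable_const a) hsq, integral_const_mul,
    integral_sub_const_sq_gaussianReal]
  simp

theorem gammaMeasure_ae_pos (α β : ℝ) : ∀ᵐ t ∂(gammaMeasure α β), 0 < t := by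
  have h0 : ∀ᵐ t ∂(gammaMeasure α β), t ≠ 0 :=
    (withDensity_absolutelyContinuous _ _).ae_le (Measure.ae_ne volume 0)
  have h1 : ∀ᵐ t ∂(gammaMeasure α β), 0 ≤ t := by
    refine (ae_withDensity_iff (measurable_gammaPDFReal α β).ennreal_ofReal).2
      (ae_of_all _ fun t ht => ?_)
    by_contra hneg
    exact ht (gammaPDF_of_neg (not_le.1 hneg))
  filter_upwards [h0, h1] with t ht ht' using lt_of_le_of_ne ht' ht.symm

theorem inv_mul_gammaPDFReal {α β t : ℝ} (hα : 1 < α) (hβ : 0 < β) (ht : 0 < t) :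
    gammaPDFReal α β t * t⁻¹ = β / (α - 1) * gammaPDFReal (α - 1) β t := by
  have hα' : 0 < α - 1 := by linarith
  have hΓ : Real.Gamma α = (α - 1) * Real.Gamma (α - 1) := by
    simpa using Real.Gamma_add_one hα'.ne'
  have hΓ' := (Real.Gamma_pos_of_pos hα').ne'
  simp only [gammaPDFReal, if_pos ht.le, hΓ, Real.rpow_sub_one ht.ne', Real.rpow_sub_one hβ.ne']
  field_simp

/-- The mean of the inverse-gamma distribution. -/
theorem lintegral_inv_gammaMeasure {α β : ℝ} (hα : 1 < α) (hβ : 0 < β) :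
    ∫⁻ t, ENNReal.ofReal t⁻¹ ∂(gammaMeasure α β) = ENNReal.ofReal (β / (α - 1)) := by
  have hα' : 0 < α - 1 := by linarith
  have hc : 0 ≤ β / (α - 1) := by positivity
  have hmeas (a : ℝ) : Measurable (gammaPDF a β) :=
    (measurable_gammaPDFReal a β).ennreal_ofReal
  rw [gammaMeasure, lintegral_withDensity_eq_lintegral_mul _ (hmeas α) (by fun_prop)]
  have h : ∀ᵐ t : ℝ, (gammaPDF α β * fun t => ENNReal.ofReal t⁻¹) t
      = ENNReal.ofReal (β / (α - 1)) * gammaPDF (α - 1) β t := by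
    filter_upwards [Measure.ae_ne volume (0 : ℝ)] with t ht
    rcases lt_or_gt_of_ne ht with ht | ht
    · simp [gammaPDF_of_neg ht]
    · simp only [Pi.mul_apply, gammaPDF]
      rw [← ENNReal.ofReal_mul (gammaPDFReal_nonneg (by linarith) hβ t),
        ← ENNReal.ofReal_mul hc, inv_mul_gammaPDFReal hα hβ ht]
  rw [lintegral_congr_ae h, lintegral_const_mul _ (hmeas (α - 1)),
    lintegral_gammaPDF_eq_one hα' hβ, mul_one]

theorem sum_sub_mean_sq_add {n : ℕ} (hn : n ≠ 0) (x : Fin n → ℝ) (c k : ℝ) :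
    ∑ i, (x i - (∑ j, x j) / n) ^ 2 + k * ((∑ j, x j) / n - c) ^ 2
      = ∑ i, (x i - c) ^ 2 + (k - n) / n ^ 2 * (∑ i, (x i - c)) ^ 2 := by
  have hn' : (n : ℝ) ≠ 0 := by exact_mod_cast hn
  simp only [sub_sq, Finset.sum_add_distrib, Finset.sum_sub_distrib, Finset.sum_const,
    Finset.card_univ, Fintype.card_fin, nsmul_eq_mul, ← Finset.sum_mul, ← Finset.mul_sum]
  field_simp
  ring

/-- Expected posterior variance for the normal model with normal-inverse-gamma prior:
under the prior predictive of `x`, `E[u_n²] = β / (n_λ·(α − 1))` with `n_λ = n + λ⁻¹`. -/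
theorem nig_expected_posterior_variance
    (μ₀ : ℝ) (l : ℝ) (hl : 0 < l) (β : ℝ) (hβ : 0 < β) (α : ℝ) (hα : 1 < α)
    (n : ℕ) (hn : 1 ≤ n) :
    ∫ x : Fin n → ℝ,
        (2 * β + (∑ i, (x i - (∑ j, x j) / n) ^ 2)
            + ((n : ℝ) / (l * ((n : ℝ) + l⁻¹))) * ((∑ j, x j) / n - μ₀) ^ 2)
          / (((n : ℝ) + l⁻¹) * ((n : ℝ) + 2 * α - 2))
      ∂(((gammaMeasure α β).map (fun t : ℝ => t⁻¹)).bind (fun s2 =>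
          (gaussianReal μ₀ (l * s2).toNNReal).bind (fun μ =>
            Measure.pi fun _ : Fin n => gaussianReal μ s2.toNNReal)))
      = β / (((n : ℝ) + l⁻¹) * (α - 1)) := by
  have hn0 : (0 : ℝ) < n := by exact_mod_cast hn
  have hα' : 0 < α - 1 := by linarith
  have hnl : 0 < (n : ℝ) + l⁻¹ := by positivity
  set k : ℝ := (n : ℝ) / (l * ((n : ℝ) + l⁻¹)) with hk
  set D : ℝ := ((n : ℝ) + l⁻¹) * ((n : ℝ) + 2 * α - 2) with hD
  have hD0 : 0 < D := mul_pos hnl (by linarith)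
  have hk0 : 0 ≤ k := by positivity
  have hkl : k * (1 / n + l) = 1 := by
    rw [hk]; field_simp; ring
  set f : (Fin n → ℝ) → ℝ := fun x =>
    (2 * β + (∑ i, (x i - (∑ j, x j) / n) ^ 2) + k * ((∑ j, x j) / n - μ₀) ^ 2) / D with hf
  have hf0 (x : Fin n → ℝ) : 0 ≤ f x := by
    have : 0 ≤ ∑ i, (x i - (∑ j, x j) / n) ^ 2 := Finset.sum_nonneg fun i _ => sq_nonneg _
    simp only [hf]; positivity
  have hfm : Measurable f := by fun_prop
  have hf_eq (x : Fin n → ℝ) : f x = 2 * β / D + 1 / D * ∑ i, (x i - μ₀) ^ 2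
      + (k - n) / n ^ 2 / D * (∑ i, (x i - μ₀)) ^ 2 := by
    simp only [hf, add_assoc, sum_sub_mean_sq_add (by omega : n ≠ 0) x μ₀ k]
    ring
  have hpi (μ : ℝ) (v : NNReal) :
      ∫⁻ x, ENNReal.ofReal (f x) ∂(Measure.pi fun _ : Fin n => gaussianReal μ v)
        = ENNReal.ofReal ((2 * β + (n - 1 + k / n) * v) / D + k / D * (μ - μ₀) ^ 2) := by
    simp_rw [hf_eq]
    rw [lintegral_quadratic_pi_gaussianReal μ μ₀ v _ _ _ fun x => by
      rw [← hf_eq]; exact hf0 x]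
    congr 1
    rw [Fintype.card_fin]
    field_simp
    ring
  have hn1 : (0 : ℝ) ≤ n - 1 := by
    have : (1 : ℝ) ≤ n := by exact_mod_cast hn
    linarith
  have hmix (s : ℝ) (hs : 0 < s) :
      ∫⁻ x, ENNReal.ofReal (f x) ∂((gaussianReal μ₀ (l * s).toNNReal).bind (fun μ =>
        Measure.pi fun _ : Fin n => gaussianReal μ s.toNNReal))
        = ENNReal.ofReal ((2 * β + n * s) / D) := by
    have hκ : Measurable fun μ : ℝ =>
        Measure.pi fun _ : Fin n => gaussianReal μ s.toNNReal :=
      measurable_pi_gaussianReal.comp (measurable_id.prodMk measurable_const)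
    rw [lintegral_ofReal_bind_congr hκ hfm
      (ae_of_all _ fun μ => hpi μ s.toNNReal),
      lintegral_quadratic_gaussianReal _ _ _ _ (by positivity) (by positivity)]
    congr 1
    rw [Real.coe_toNNReal _ hs.le, Real.coe_toNNReal _ (by positivity)]
    linear_combination s / D * hkl
  rw [integral_eq_lintegral_of_nonneg_ae (ae_of_all _ hf0) hfm.aestronglyMeasurable]
  have hpos : ∀ᵐ s ∂((gammaMeasure α β).map (fun t : ℝ => t⁻¹)), 0 < s := by
    rw [ae_map_iff measurable_inv.aemeasurable measurableSet_Ioi]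
    filter_upwards [gammaMeasure_ae_pos α β] with t ht using inv_pos.2 ht
  have := isProbabilityMeasure_gammaMeasure (by linarith : 0 < α) hβ
  rw [lintegral_ofReal_bind_congr (measurable_gaussianReal_bind_pi μ₀ l) hfm
    (hpos.mono hmix), lintegral_map (by fun_prop) measurable_inv]
  have hsplit : ∀ᵐ t ∂(gammaMeasure α β), ENNReal.ofReal ((2 * β + n * t⁻¹) / D)
      = ENNReal.ofReal (2 * β / D) + ENNReal.ofReal (n / D) * ENNReal.ofReal t⁻¹ := by
    filter_upwards [gammaMeasure_ae_pos α β] with t ht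
    rw [← ENNReal.ofReal_mul (by positivity), ← ENNReal.ofReal_add (by positivity) (by positivity)]
    congr 1
    ring
  rw [lintegral_congr_ae hsplit, lintegral_add_left measurable_const,
    lintegral_const_mul _ (by fun_prop), lintegral_inv_gammaMeasure hα hβ, lintegral_const,
    measure_univ, mul_one, ← ENNReal.ofReal_mul (by positivity),
    ← ENNReal.ofReal_add (by positivity) (by positivity), ENNReal.toReal_ofReal (by positivity)]
  have hne : (n : ℝ) + 2 * α - 2 ≠ 0 := by linarith
  rw [hD]
  field_simp
  ring
end

section
/- Variance of the posterior variance for the normal model with normal-inverse-gamma prior: For all hyperparameters μ₀ ∈ ℝ, λ > 0, β > 0, α > 2 and all n ≥ 1, the variance of u_n²(x) = (2β + Σᵢ(xᵢ − x̄)² + (n/(λ·n_λ))·(x̄ − μ₀)²) / (n_λ·(n + 2α − 2)) under the joint normal-inverse-gamma sampling model (i.e. under the prior predictive of x) equals β²·n / (n_λ²·(α − 1)²·(α − 2)·(n + 2α − 2)); equivalently, its standard deviation is (β/(n_λ·(α − 1)·(α − 2)^{1/2}))·(n/(n + 2α − 2))^{1/2}, where n_λ = n + λ^{−1}. -/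
open MeasureTheory ProbabilityTheory

lemma integrable_pow_gaussianReal (k : ℕ) :
    Integrable (fun x : ℝ => x ^ k) (gaussianReal 0 1) := by
  have h := (memLp_id_gaussianReal' (μ := 0) (v := 1) (k : ENNReal) (by simp)).integrable_norm_pow'
  refine (integrable_norm_iff (by fun_prop)).1 ?_
  simpa using h

lemma integral_pow_gaussianReal :
    ∫ x, x ∂(gaussianReal 0 1) = 0 ∧ ∫ x, x ^ 2 ∂(gaussianReal 0 1) = 1 ∧
      ∫ x, x ^ 3 ∂(gaussianReal 0 1) = 0 ∧ ∫ x, x ^ 4 ∂(gaussianReal 0 1) = 3 := by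
  have hexp : ∀ t : ℝ, HasDerivAt (fun t : ℝ => Real.exp (t ^ 2 / 2)) (t * Real.exp (t ^ 2 / 2)) t := by
    intro t
    refine (((hasDerivAt_id' t).fun_pow 2).div_const 2).exp.congr_deriv ?_
    simp only [Nat.cast_ofNat, Nat.add_one_sub_one, pow_one]; ring
  have hd : ∀ p p' : ℝ → ℝ, (∀ t, HasDerivAt p (p' t) t) →
      deriv (fun t => p t * Real.exp (t ^ 2 / 2)) =
        fun t => (p' t + t * p t) * Real.exp (t ^ 2 / 2) := by
    intro p p' hp
    funext t
    rw [((hp t).fun_mul (hexp t)).deriv]; ring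
  have hk : ∀ k : ℕ, ∫ x, x ^ k ∂(gaussianReal 0 1)
      = iteratedDeriv k (fun t : ℝ => Real.exp (t ^ 2 / 2)) 0 := by
    intro k
    have h := iteratedDeriv_mgf_zero (X := id) (μ := gaussianReal 0 1)
      (by simp [integrableExpSet_id_gaussianReal]) k
    rw [mgf_id_gaussianReal] at h
    simpa using h.symm
  have h1 : iteratedDeriv 1 (fun t : ℝ => Real.exp (t ^ 2 / 2)) =
      fun t => t * Real.exp (t ^ 2 / 2) := by
    rw [iteratedDeriv_one]; funext t; exact (hexp t).deriv
  have h2 : iteratedDeriv 2 (fun t : ℝ => Real.exp (t ^ 2 / 2)) =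
      fun t => (1 + t * t) * Real.exp (t ^ 2 / 2) := by
    rw [iteratedDeriv_succ, h1]; exact hd _ _ (fun t => hasDerivAt_id t)
  have h3 : iteratedDeriv 3 (fun t : ℝ => Real.exp (t ^ 2 / 2)) =
      fun t => (2 * t + t * (1 + t * t)) * Real.exp (t ^ 2 / 2) := by
    rw [iteratedDeriv_succ, h2]
    refine hd _ _ (fun t => ?_)
    exact (((hasDerivAt_id' t).fun_mul (hasDerivAt_id' t)).const_add 1).congr_deriv (by ring)
  have h4 : iteratedDeriv 4 (fun t : ℝ => Real.exp (t ^ 2 / 2)) =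
      fun t => ((3 + 3 * t ^ 2) + t * (2 * t + t * (1 + t * t))) * Real.exp (t ^ 2 / 2) := by
    rw [iteratedDeriv_succ, h3]
    refine hd _ _ (fun t => ?_)
    exact (((hasDerivAt_id' t).const_mul 2).fun_add ((hasDerivAt_id' t).fun_mul
      (((hasDerivAt_id' t).fun_mul (hasDerivAt_id' t)).const_add 1))).congr_deriv (by ring)
  refine ⟨?_, ?_, ?_, ?_⟩
  · have := hk 1; simp only [pow_one, h1] at this; simp [this]
  · rw [hk, h2]; simp
  · rw [hk, h3]; simp
  · rw [hk, h4]; simp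

lemma integrable_and_integral_sum_sq_pow_mul_sum_pow_succ {n : ℕ}
    (h : ∀ a b : ℕ, Integrable (fun x : Fin n → ℝ => (∑ i, x i ^ 2) ^ a * (∑ i, x i) ^ b)
      (Measure.pi fun _ => gaussianReal 0 1)) (a b : ℕ) :
    Integrable (fun x : Fin (n + 1) → ℝ => (∑ i, x i ^ 2) ^ a * (∑ i, x i) ^ b)
      (Measure.pi fun _ => gaussianReal 0 1) ∧
    ∫ x : Fin (n + 1) → ℝ, (∑ i, x i ^ 2) ^ a * (∑ i, x i) ^ b
        ∂(Measure.pi fun _ => gaussianReal 0 1) =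
      ∑ i ∈ Finset.range (a + 1), ∑ j ∈ Finset.range (b + 1), (a.choose i * b.choose j : ℝ) *
        ((∫ z, z ^ (2 * i + j) ∂(gaussianReal 0 1)) *
          ∫ x : Fin n → ℝ, (∑ i, x i ^ 2) ^ (a - i) * (∑ i, x i) ^ (b - j)
            ∂(Measure.pi fun _ => gaussianReal 0 1)) := by
  have hmp := (measurePreserving_piFinSuccAbove
    (fun _ : Fin (n + 1) => gaussianReal 0 1) 0).symm
  have hterm (i j : ℕ) : Integrable (fun p : ℝ × (Fin n → ℝ) => (a.choose i * b.choose j : ℝ) *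
      (p.1 ^ (2 * i + j) * ((∑ i, p.2 i ^ 2) ^ (a - i) * (∑ i, p.2 i) ^ (b - j))))
      ((gaussianReal 0 1).prod (Measure.pi fun _ => gaussianReal 0 1)) :=
    ((integrable_pow_gaussianReal _).mul_prod (h _ _)).const_mul _
  have hexpand (p : ℝ × (Fin n → ℝ)) :
      (p.1 ^ 2 + ∑ i, p.2 i ^ 2) ^ a * (p.1 + ∑ i, p.2 i) ^ b =
      ∑ i ∈ Finset.range (a + 1), ∑ j ∈ Finset.range (b + 1), (a.choose i * b.choose j : ℝ) *
      (p.1 ^ (2 * i + j) * ((∑ i, p.2 i ^ 2) ^ (a - i) * (∑ i, p.2 i) ^ (b - j))) := by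
    rw [add_pow, add_pow, Finset.sum_mul_sum]
    refine Finset.sum_congr rfl fun i _ => Finset.sum_congr rfl fun j _ => ?_
    rw [pow_add, pow_mul]; ring
  constructor
  · rw [← hmp.integrable_comp_emb (MeasurableEquiv.measurableEmbedding _)]
    simp only [MeasurableEquiv.piFinSuccAbove_symm_apply, Fin.insertNthEquiv,
      Fin.sum_univ_succ, Fin.insertNth_zero, Function.comp_def, Equiv.coe_fn_mk, Fin.cons_succ,
      Fin.zero_succAbove, cast_eq, Fin.cons_zero, hexpand]
    exact integrable_finsetSum _ fun i _ => integrable_finsetSum _ fun j _ => hterm i j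
  · rw [← hmp.integral_comp']
    simp only [MeasurableEquiv.piFinSuccAbove_symm_apply, Fin.insertNthEquiv,
      Fin.sum_univ_succ, Fin.insertNth_zero, Equiv.coe_fn_mk, Fin.cons_succ,
      Fin.zero_succAbove, cast_eq, Fin.cons_zero, hexpand]
    rw [integral_finsetSum _ fun i _ => integrable_finsetSum _ fun j _ => hterm i j]
    refine Finset.sum_congr rfl fun i _ => ?_
    rw [integral_finsetSum _ fun j _ => hterm i j]
    refine Finset.sum_congr rfl fun j _ => ?_
    rw [integral_const_mul]
    congr 1
    exact integral_prod_mul (fun z : ℝ => z ^ (2 * i + j))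
      (fun x : Fin n → ℝ => (∑ i, x i ^ 2) ^ (a - i) * (∑ i, x i) ^ (b - j))

lemma integrable_sum_sq_pow_mul_sum_pow (n a b : ℕ) :
    Integrable (fun x : Fin n → ℝ => (∑ i, x i ^ 2) ^ a * (∑ i, x i) ^ b)
      (Measure.pi fun _ => gaussianReal 0 1) := by
  induction n generalizing a b with
  | zero => simp
  | succ n ih => exact (integrable_and_integral_sum_sq_pow_mul_sum_pow_succ ih a b).1

lemma integral_sum_sq_pow_mul_sum_pow (n : ℕ) :
    let G : ℕ → ℕ → ℝ := fun a b => ∫ x : Fin n → ℝ, (∑ i, x i ^ 2) ^ a * (∑ i, x i) ^ b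
      ∂(Measure.pi fun _ => gaussianReal 0 1)
    G 0 1 = 0 ∧ G 0 2 = n ∧ G 0 3 = 0 ∧ G 0 4 = 3 * n ^ 2 ∧ G 1 0 = n ∧ G 1 1 = 0 ∧
      G 1 2 = n * (n + 2) ∧ G 2 0 = n * (n + 2) := by
  intro G
  obtain ⟨m1, m2, m3, m4⟩ := integral_pow_gaussianReal
  induction n with
  | zero => simp [G]
  | succ n ih =>
    have step := fun a b => (integrable_and_integral_sum_sq_pow_mul_sum_pow_succ
      (integrable_sum_sq_pow_mul_sum_pow n) a b).2
    obtain ⟨h1, h2, h3, h4, h5, h6, h7, h8⟩ := ih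
    simp only [pow_zero, pow_one, one_mul, mul_one] at h1 h2 h3 h4 h5 h6 h7 h8
    refine ⟨?_, ?_, ?_, ?_, ?_, ?_, ?_, ?_⟩ <;> simp only [G] <;> rw [step] <;>
      simp [Finset.sum_range_succ, Nat.choose, h1, h2, h3, h4, h5, h6, h7, h8, m1, m2, m3, m4] <;>
      ring

lemma integrable_and_integral_pow_mul_sum_sq_pow_mul_sum_pow (n k a b : ℕ) :
    Integrable (fun p : ℝ × (Fin n → ℝ) => p.1 ^ k * ((∑ i, p.2 i ^ 2) ^ a * (∑ i, p.2 i) ^ b))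
      ((gaussianReal 0 1).prod (Measure.pi fun _ => gaussianReal 0 1)) ∧
    ∫ p : ℝ × (Fin n → ℝ), p.1 ^ k * ((∑ i, p.2 i ^ 2) ^ a * (∑ i, p.2 i) ^ b)
      ∂((gaussianReal 0 1).prod (Measure.pi fun _ => gaussianReal 0 1)) =
    (∫ z, z ^ k ∂(gaussianReal 0 1)) * ∫ x : Fin n → ℝ, (∑ i, x i ^ 2) ^ a * (∑ i, x i) ^ b
      ∂(Measure.pi fun _ => gaussianReal 0 1) :=
  ⟨(integrable_pow_gaussianReal k).mul_prod (integrable_sum_sq_pow_mul_sum_pow n a b),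
    integral_prod_mul (fun z : ℝ => z ^ k)
      (fun x : Fin n → ℝ => (∑ i, x i ^ 2) ^ a * (∑ i, x i) ^ b)⟩

lemma integrable_and_integral_quadratic_form (n : ℕ) (d e f : ℝ) :
    let ν := (gaussianReal 0 1).prod (Measure.pi fun _ : Fin n => gaussianReal 0 1)
    let R : ℝ × (Fin n → ℝ) → ℝ := fun p =>
      (∑ i, p.2 i ^ 2) + d * (∑ i, p.2 i) ^ 2 + e * p.1 * (∑ i, p.2 i) + f * p.1 ^ 2
    Integrable R ν ∧ Integrable (fun p => R p ^ 2) ν ∧ ∫ p, R p ∂ν = n + d * n + f ∧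
      ∫ p, R p ^ 2 ∂ν = n * (n + 2) + 3 * d ^ 2 * n ^ 2 + e ^ 2 * n + 3 * f ^ 2
        + 2 * d * (n * (n + 2)) + 2 * f * n + 2 * d * f * n := by
  intro ν R
  obtain ⟨m1, m2, m3, m4⟩ := integral_pow_gaussianReal
  obtain ⟨h1, h2, h3, h4, h5, h6, h7, h8⟩ := integral_sum_sq_pow_mul_sum_pow n
  let M : ℕ → ℕ → ℕ → ℝ × (Fin n → ℝ) → ℝ := fun k a b p =>
    p.1 ^ k * ((∑ i, p.2 i ^ 2) ^ a * (∑ i, p.2 i) ^ b)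
  have hI (c : ℝ) (k a b : ℕ) : Integrable (fun p => c * M k a b p) ν :=
    (integrable_and_integral_pow_mul_sum_sq_pow_mul_sum_pow n k a b).1.const_mul c
  have hE (c : ℝ) (k a b : ℕ) : ∫ p, c * M k a b p ∂ν =
      c * ((∫ z, z ^ k ∂(gaussianReal 0 1)) * ∫ x : Fin n → ℝ, (∑ i, x i ^ 2) ^ a * (∑ i, x i) ^ b
        ∂(Measure.pi fun _ => gaussianReal 0 1)) := by
    rw [integral_const_mul]
    congr 1
    exact (integrable_and_integral_pow_mul_sum_sq_pow_mul_sum_pow n k a b).2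
  have hR : R = fun p => 1 * M 0 1 0 p + d * M 0 0 2 p + e * M 1 0 1 p + f * M 2 0 0 p := by
    funext p; simp only [R, M]; ring
  have hR2 : (fun p => R p ^ 2) = fun p => 1 * M 0 2 0 p + d ^ 2 * M 0 0 4 p
      + e ^ 2 * M 2 0 2 p + f ^ 2 * M 4 0 0 p + 2 * d * M 0 1 2 p + 2 * e * M 1 1 1 p
      + 2 * f * M 2 1 0 p + 2 * d * e * M 1 0 3 p + 2 * d * f * M 2 0 2 p
      + 2 * e * f * M 3 0 1 p := by
    funext p; simp only [R, M]; ring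
  rw [hR2, hR]
  refine ⟨?_, ?_, ?_, ?_⟩
  · repeat' apply Integrable.fun_add
    all_goals apply hI
  · repeat' apply Integrable.fun_add
    all_goals apply hI
  · repeat rw [integral_add]
    · simp only [hE, h2, h1, h5]
      simp [m1, m2]
    all_goals
      repeat' apply Integrable.fun_add
      all_goals apply hI
  · repeat rw [integral_add]
    · simp only [hE, h1, h2, h3, h4, h5, h6, h7, h8]
      simp [m1, m2, m3, m4]
      ring
    all_goals
      repeat' apply Integrable.fun_add
      all_goals apply hI

lemma ae_pos_gammaMeasure (a r : ℝ) : ∀ᵐ t ∂(gammaMeasure a r), 0 < t := by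
  have hm : Measurable (gammaPDF a r) := (measurable_gammaPDFReal a r).ennreal_ofReal
  rw [gammaMeasure, ae_withDensity_iff hm]
  filter_upwards [Measure.ae_ne volume (0 : ℝ)] with t ht h
  refine lt_of_le_of_ne (not_lt.1 fun h' => h (gammaPDF_of_neg h')) ht.symm

lemma lintegral_mul_ofReal_inv_gammaMeasure {a r : ℝ} (ha : 0 < a) (hr : 0 < r)
    {g : ℝ → ENNReal} (hg : Measurable g) :
    ∫⁻ t, g t * ENNReal.ofReal t⁻¹ ∂(gammaMeasure (a + 1) r) =
      ENNReal.ofReal (r / a) * ∫⁻ t, g t ∂(gammaMeasure a r) := by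
  have hm (b : ℝ) : Measurable (gammaPDF b r) := (measurable_gammaPDFReal b r).ennreal_ofReal
  have hgi : Measurable fun t => g t * ENNReal.ofReal t⁻¹ := by fun_prop
  rw [gammaMeasure, gammaMeasure, lintegral_withDensity_eq_lintegral_mul _ (hm _) hgi,
    lintegral_withDensity_eq_lintegral_mul _ (hm _) hg,
    ← lintegral_const_mul _ ((hm a).mul hg)]
  refine lintegral_congr_ae ?_
  filter_upwards [Measure.ae_ne volume (0 : ℝ)] with t ht
  simp only [Pi.mul_apply]
  rcases lt_or_gt_of_ne ht with h | h
  · simp [gammaPDF_of_neg h]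
  · have key : gammaPDF (a + 1) r t * ENNReal.ofReal t⁻¹ =
        ENNReal.ofReal (r / a) * gammaPDF a r t := by
      rw [gammaPDF_of_nonneg h.le, gammaPDF_of_nonneg h.le, ← ENNReal.ofReal_mul' (by positivity),
        ← ENNReal.ofReal_mul (by positivity)]
      congr 1
      have h1 := Real.rpow_sub_one h.ne' a
      have h2 := (Real.Gamma_pos_of_pos ha).ne'
      rw [Real.Gamma_add_one ha.ne', Real.rpow_add_one hr.ne', add_sub_cancel_right, h1]
      field_simp
    rw [mul_left_comm, key]; ring

lemma integrable_and_integral_inv_gammaMeasure {a r : ℝ} (ha : 1 < a) (hr : 0 < r) :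
    Integrable (fun t => t⁻¹) (gammaMeasure a r) ∧
      ∫ t, t⁻¹ ∂(gammaMeasure a r) = r / (a - 1) := by
  have ha1 : 0 < a - 1 := sub_pos.2 ha
  have hprob := isProbabilityMeasure_gammaMeasure ha1 hr
  have hl : ∫⁻ t, ENNReal.ofReal t⁻¹ ∂(gammaMeasure a r) = ENNReal.ofReal (r / (a - 1)) := by
    have := lintegral_mul_ofReal_inv_gammaMeasure ha1 hr (g := fun _ => 1) measurable_const
    simpa using this
  have hm : AEStronglyMeasurable (fun t : ℝ => t⁻¹) (gammaMeasure a r) :=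
    measurable_inv.aestronglyMeasurable
  have hnn : 0 ≤ᵐ[gammaMeasure a r] fun t => t⁻¹ := by
    filter_upwards [ae_pos_gammaMeasure a r] with t ht using (inv_pos.2 ht).le
  refine ⟨(lintegral_ofReal_ne_top_iff_integrable hm hnn).1 (hl ▸ ENNReal.ofReal_ne_top), ?_⟩
  rw [integral_eq_lintegral_of_nonneg_ae hnn hm, hl, ENNReal.toReal_ofReal (by positivity)]

lemma integrable_and_integral_inv_sq_gammaMeasure {a r : ℝ} (ha : 2 < a) (hr : 0 < r) :
    Integrable (fun t => t⁻¹ ^ 2) (gammaMeasure a r) ∧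
      ∫ t, t⁻¹ ^ 2 ∂(gammaMeasure a r) = r ^ 2 / ((a - 1) * (a - 2)) := by
  have ha1 : 0 < a - 1 := by linarith
  have ha2 : 0 < a - 1 - 1 := by linarith
  have hprob := isProbabilityMeasure_gammaMeasure ha2 hr
  have hl : ∫⁻ t, ENNReal.ofReal (t⁻¹ ^ 2) ∂(gammaMeasure a r) =
      ENNReal.ofReal (r ^ 2 / ((a - 1) * (a - 2))) := by
    have h1 := lintegral_mul_ofReal_inv_gammaMeasure ha1 hr (g := fun t => ENNReal.ofReal t⁻¹)
      (by fun_prop)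
    have h2 := lintegral_mul_ofReal_inv_gammaMeasure ha2 hr (g := fun _ => 1) measurable_const
    simp only [sub_add_cancel, one_mul, lintegral_const, measure_univ, mul_one] at h1 h2
    rw [h2, ← ENNReal.ofReal_mul (by positivity)] at h1
    calc _ = ∫⁻ t, ENNReal.ofReal t⁻¹ * ENNReal.ofReal t⁻¹ ∂(gammaMeasure a r) := by
          refine lintegral_congr_ae ?_
          filter_upwards [ae_pos_gammaMeasure a r] with t ht
          rw [← ENNReal.ofReal_mul (inv_pos.2 ht).le, sq]
      _ = _ := by
          rw [h1, show a - 2 = a - 1 - 1 by ring]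
          congr 1
          field_simp
  have hm : AEStronglyMeasurable (fun t : ℝ => t⁻¹ ^ 2) (gammaMeasure a r) :=
    (measurable_inv.pow_const 2).aestronglyMeasurable
  have hnn : 0 ≤ᵐ[gammaMeasure a r] fun t => t⁻¹ ^ 2 := ae_of_all _ fun t => sq_nonneg _
  refine ⟨(lintegral_ofReal_ne_top_iff_integrable hm hnn).1 (hl ▸ ENNReal.ofReal_ne_top), ?_⟩
  rw [integral_eq_lintegral_of_nonneg_ae hnn hm, hl, ENNReal.toReal_ofReal]
  have : 0 < a - 2 := by linarith
  positivity

lemma measurable_map_of_uncurry {X Y Z : Type*} [MeasurableSpace X] [MeasurableSpace Y]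
    [MeasurableSpace Z] (ν : Measure Y) [SFinite ν] {f : X → Y → Z}
    (hf : Measurable (Function.uncurry f)) : Measurable fun x => ν.map (f x) := by
  refine Measure.measurable_of_measurable_coe _ fun s hs => ?_
  have h (x : X) : ν.map (f x) s = ν (Prod.mk x ⁻¹' (Function.uncurry f ⁻¹' s)) := by
    rw [Measure.map_apply hf.of_uncurry_left hs]; rfl
  simp_rw [h]
  exact measurable_measure_prodMk_left (hf hs)

lemma bind_map_eq_map_prod {X Y Z : Type*} [MeasurableSpace X] [MeasurableSpace Y]
    [MeasurableSpace Z] (μ : Measure X) (ν : Measure Y) [SFinite ν] {f : X → Y → Z}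
    (hf : Measurable (Function.uncurry f)) :
    μ.bind (fun x => ν.map (f x)) = (μ.prod ν).map (Function.uncurry f) := by
  ext s hs
  rw [Measure.bind_apply hs (measurable_map_of_uncurry ν hf).aemeasurable,
    Measure.map_apply hf hs, Measure.prod_apply (hf hs)]
  refine lintegral_congr fun x => ?_
  rw [Measure.map_apply hf.of_uncurry_left hs]; rfl

lemma map_bind_eq_bind_comp {X Y Z : Type*} [MeasurableSpace X] [MeasurableSpace Y] [MeasurableSpace Z]
    (μ : Measure X) {g : X → Y} (hg : Measurable g) {κ : Y → Measure Z} (hκ : Measurable κ) :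
    (μ.map g).bind κ = μ.bind fun x => κ (g x) := by
  ext s hs
  rw [Measure.bind_apply hs hκ.aemeasurable, Measure.bind_apply (f := fun x => κ (g x)) hs (hκ.comp hg).aemeasurable,
    lintegral_map (f := fun y => κ y s) ((Measure.measurable_coe hs).comp hκ) hg]

lemma gaussianReal_eq_map (m v : ℝ) :
    gaussianReal m v.toNNReal = (gaussianReal 0 1).map (fun z => m + √v * z) := by
  have h : (fun z => m + √v * z) = (fun y => m + y) ∘ (fun z => √v * z) := rfl
  rw [h, ← Measure.map_map (by fun_prop) (by fun_prop), gaussianReal_map_const_mul,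
    gaussianReal_map_const_add]
  congr 1
  · simp
  · ext
    rcases le_total v 0 with hv | hv
    · simp [Real.sqrt_eq_zero_of_nonpos hv, hv]
    · simp [hv, Real.sq_sqrt hv]

lemma pi_gaussianReal_eq_map (ι : Type*) [Fintype ι] (m v : ℝ) :
    (Measure.pi fun _ : ι => gaussianReal m v.toNNReal) =
      (Measure.pi fun _ : ι => gaussianReal 0 1).map (fun z i => m + √v * z i) := by
  rw [gaussianReal_eq_map]
  exact (Measure.pi_map_pi (μ := fun _ : ι => gaussianReal 0 1)
    (f := fun _ z => m + √v * z) (fun _ => by fun_prop)).symm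

lemma nig_predictive_eq_map (μ₀ l α β : ℝ) (n : ℕ) :
    (((gammaMeasure α β).map (fun t : ℝ => t⁻¹)).bind (fun s2 =>
          (gaussianReal μ₀ (l * s2).toNNReal).bind (fun μ =>
            Measure.pi fun _ : Fin n => gaussianReal μ s2.toNNReal))) =
    ((gammaMeasure α β).prod ((gaussianReal 0 1).prod
      (Measure.pi fun _ : Fin n => gaussianReal 0 1))).map
      (fun p i => μ₀ + √(l * p.1⁻¹) * p.2.1 + √p.1⁻¹ * p.2.2 i) := by
  have hinner (s : ℝ) : (gaussianReal μ₀ (l * s).toNNReal).bind (fun μ =>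
      Measure.pi fun _ : Fin n => gaussianReal μ s.toNNReal) =
      ((gaussianReal 0 1).prod (Measure.pi fun _ : Fin n => gaussianReal 0 1)).map
        (fun p i => μ₀ + √(l * s) * p.1 + √s * p.2 i) := by
    simp_rw [pi_gaussianReal_eq_map, gaussianReal_eq_map μ₀]
    rw [map_bind_eq_bind_comp _ (by fun_prop) (measurable_map_of_uncurry _ (by fun_prop))]
    exact bind_map_eq_map_prod (gaussianReal 0 1) (Measure.pi fun _ : Fin n => gaussianReal 0 1)
      (f := fun z w i => μ₀ + √(l * s) * z + √s * w i) (by fun_prop)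
  simp_rw [hinner]
  rw [map_bind_eq_bind_comp _ measurable_inv (measurable_map_of_uncurry _ (by fun_prop))]
  have hp : SFinite (gammaMeasure α β) := by unfold gammaMeasure; infer_instance
  exact bind_map_eq_map_prod (gammaMeasure α β)
    ((gaussianReal 0 1).prod (Measure.pi fun _ : Fin n => gaussianReal 0 1))
    (f := fun (t : ℝ) (p : ℝ × (Fin n → ℝ)) i =>
      μ₀ + √(l * t⁻¹) * p.1 + √t⁻¹ * p.2 i) (by fun_prop)

lemma sum_sub_mean_sq_affine {n : ℕ} (hn : n ≠ 0) (m s : ℝ) (z : Fin n → ℝ) :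
    ∑ i, (m + s * z i - (∑ j, (m + s * z j)) / n) ^ 2 =
      s ^ 2 * (∑ i, z i ^ 2 - (∑ i, z i) ^ 2 / n) := by
  have hn' : (n : ℝ) ≠ 0 := Nat.cast_ne_zero.2 hn
  have hmean : (∑ j, (m + s * z j)) / n = m + s * (∑ j, z j) / n := by
    rw [Finset.sum_add_distrib, ← Finset.mul_sum]
    simp; field_simp
  have hterm (i : Fin n) : (m + s * z i - (m + s * (∑ j, z j) / n)) ^ 2 =
      s ^ 2 * z i ^ 2 - (2 * s ^ 2 * (∑ j, z j) / n) * z i + s ^ 2 * (∑ j, z j) ^ 2 / n ^ 2 := by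
    ring
  simp_rw [hmean, hterm]
  rw [Finset.sum_add_distrib, Finset.sum_sub_distrib, ← Finset.mul_sum, ← Finset.mul_sum]
  simp; field_simp; ring

lemma nig_predictive_variance {l : ℝ} (hl : 0 < l) {β : ℝ} (hβ : 0 < β) {α : ℝ} (hα : 2 < α)
    (μ₀ : ℝ) {n : ℕ} (hn : n ≠ 0) :
    variance (fun x : Fin n → ℝ =>
        (2 * β + (∑ i, (x i - (∑ j, x j) / n) ^ 2)
            + ((n : ℝ) / (l * ((n : ℝ) + l⁻¹))) * ((∑ j, x j) / n - μ₀) ^ 2)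
          / (((n : ℝ) + l⁻¹) * ((n : ℝ) + 2 * α - 2)))
        (((gammaMeasure α β).map (fun t : ℝ => t⁻¹)).bind (fun s2 =>
          (gaussianReal μ₀ (l * s2).toNNReal).bind (fun μ =>
            Measure.pi fun _ : Fin n => gaussianReal μ s2.toNNReal)))
      = β ^ 2 * (n : ℝ)
          / (((n : ℝ) + l⁻¹) ^ 2 * (α - 1) ^ 2 * (α - 2) * ((n : ℝ) + 2 * α - 2)) := by
  have hn' : (0 : ℝ) < n := Nat.cast_pos.2 (Nat.pos_of_ne_zero hn)
  have hα1 : 0 < α - 1 := by linarith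
  have hα2 : 0 < α - 2 := by linarith
  have hN : 0 < (n : ℝ) + 2 * α - 2 := by linarith
  have hprob := isProbabilityMeasure_gammaMeasure (a := α) (by linarith) hβ
  rw [nig_predictive_eq_map, variance_map (by fun_prop) (by fun_prop)]
  set ν := (gaussianReal 0 1).prod (Measure.pi fun _ : Fin n => gaussianReal 0 1)
  set D := ((n : ℝ) + l⁻¹) * ((n : ℝ) + 2 * α - 2) with hD
  set c := (n : ℝ) / (l * ((n : ℝ) + l⁻¹)) with hc
  have hcl : c = n / (l * n + 1) := by rw [hc]; congr 1; field_simp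
  obtain ⟨hI1, hI2, hE1, hE2⟩ :=
    integrable_and_integral_quadratic_form n (c / n ^ 2 - 1 / n) (2 * c / n * √l) (c * l)
  set R : ℝ × (Fin n → ℝ) → ℝ := fun p =>
    (∑ i, p.2 i ^ 2) + (c / n ^ 2 - 1 / n) * (∑ i, p.2 i) ^ 2
      + (2 * c / n * √l) * p.1 * (∑ i, p.2 i) + c * l * p.1 ^ 2 with hR
  obtain ⟨hT1, hET1⟩ := integrable_and_integral_inv_gammaMeasure (a := α) (by linarith) hβ
  obtain ⟨hT2, hET2⟩ := integrable_and_integral_inv_sq_gammaMeasure hα hβ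
  have hRm : Measurable R := by fun_prop
  have hQm : AEStronglyMeasurable (fun p : ℝ × (ℝ × (Fin n → ℝ)) => p.1⁻¹ * R p.2)
      ((gammaMeasure α β).prod ν) := by fun_prop
  have hsq : (fun p : ℝ × (ℝ × (Fin n → ℝ)) => p.1⁻¹ * R p.2) ^ 2 =
      fun p => p.1⁻¹ ^ 2 * R p.2 ^ 2 := by funext p; simp [mul_pow]
  have hLp : MemLp (fun p : ℝ × (ℝ × (Fin n → ℝ)) => p.1⁻¹ * R p.2) 2
      ((gammaMeasure α β).prod ν) := by
    rw [memLp_two_iff_integrable_sq hQm]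
    exact (hT2.mul_prod hI2).congr (ae_of_all _ fun p => (mul_pow _ _ 2).symm)
  have hae : (fun x : Fin n → ℝ => (2 * β + (∑ i, (x i - (∑ j, x j) / n) ^ 2)
      + c * ((∑ j, x j) / n - μ₀) ^ 2) / D) ∘
      (fun p : ℝ × (ℝ × (Fin n → ℝ)) => fun i => μ₀ + √(l * p.1⁻¹) * p.2.1 + √p.1⁻¹ * p.2.2 i)
      =ᵐ[(gammaMeasure α β).prod ν] fun p => 2 * β / D + D⁻¹ * (p.1⁻¹ * R p.2) := by
    have hpos := Measure.quasiMeasurePreserving_fst (μ := gammaMeasure α β) (ν := ν) |>.ae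
      (ae_pos_gammaMeasure α β)
    filter_upwards [hpos] with p hp
    have hs : √p.1⁻¹ ^ 2 = p.1⁻¹ := Real.sq_sqrt (inv_pos.2 hp).le
    have hsl : √l ^ 2 = l := Real.sq_sqrt hl.le
    have hmean : (∑ j, (μ₀ + √(l * p.1⁻¹) * p.2.1 + √p.1⁻¹ * p.2.2 j)) / n - μ₀ =
        √p.1⁻¹ * (√l * p.2.1 + (∑ j, p.2.2 j) / n) := by
      rw [Finset.sum_add_distrib, ← Finset.mul_sum, Real.sqrt_mul hl.le]
      simp; field_simp; ring
    simp only [Function.comp_apply]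
    rw [sum_sub_mean_sq_affine hn, hmean, mul_pow, hs]
    simp only [hR]
    linear_combination (c * p.1⁻¹ * p.2.1 ^ 2 / D) * hsl
  rw [variance_congr hae, variance_const_add (hQm.const_mul _), variance_const_mul,
    variance_eq_sub hLp, hsq]
  have h1 : ∫ p, p.1⁻¹ * R p.2 ∂((gammaMeasure α β).prod ν) = β / (α - 1) * ∫ p, R p ∂ν := by
    rw [← hET1]; exact integral_prod_mul (fun t : ℝ => t⁻¹) R
  have h2 : ∫ p, p.1⁻¹ ^ 2 * R p.2 ^ 2 ∂((gammaMeasure α β).prod ν) =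
      β ^ 2 / ((α - 1) * (α - 2)) * ∫ p, R p ^ 2 ∂ν := by
    rw [← hET2]; exact integral_prod_mul (fun t : ℝ => t⁻¹ ^ 2) (fun p => R p ^ 2)
  have hm1 : ∫ p, R p ∂ν = n := by
    rw [hE1, hcl]; field_simp; ring
  have hm2 : ∫ p, R p ^ 2 ∂ν = n * (n + 2) := by
    rw [hE2, mul_pow _ √l, Real.sq_sqrt hl.le, hcl]; field_simp; ring
  rw [h1, h2, hm1, hm2, hD]
  field_simp
  ring

/-- Variance of the posterior variance for the normal model with normal-inverse-gamma prior:
under the prior predictive of `x`,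
`Var(u_n²) = β²·n / (n_λ²·(α − 1)²·(α − 2)·(n + 2α − 2))` with `n_λ = n + λ⁻¹`;
equivalently, the standard deviation is
`(β/(n_λ·(α − 1)·(α − 2)^{1/2}))·(n/(n + 2α − 2))^{1/2}`. -/
theorem nig_variance_posterior_variance
    (μ₀ : ℝ) (l : ℝ) (hl : 0 < l) (β : ℝ) (hβ : 0 < β) (α : ℝ) (hα : 2 < α)
    (n : ℕ) (hn : 1 ≤ n) :
    variance (fun x : Fin n → ℝ =>
        (2 * β + (∑ i, (x i - (∑ j, x j) / n) ^ 2)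
            + ((n : ℝ) / (l * ((n : ℝ) + l⁻¹))) * ((∑ j, x j) / n - μ₀) ^ 2)
          / (((n : ℝ) + l⁻¹) * ((n : ℝ) + 2 * α - 2)))
        (((gammaMeasure α β).map (fun t : ℝ => t⁻¹)).bind (fun s2 =>
          (gaussianReal μ₀ (l * s2).toNNReal).bind (fun μ =>
            Measure.pi fun _ : Fin n => gaussianReal μ s2.toNNReal)))
      = β ^ 2 * (n : ℝ)
          / (((n : ℝ) + l⁻¹) ^ 2 * (α - 1) ^ 2 * (α - 2) * ((n : ℝ) + 2 * α - 2)) ∧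
    Real.sqrt (variance (fun x : Fin n → ℝ =>
        (2 * β + (∑ i, (x i - (∑ j, x j) / n) ^ 2)
            + ((n : ℝ) / (l * ((n : ℝ) + l⁻¹))) * ((∑ j, x j) / n - μ₀) ^ 2)
          / (((n : ℝ) + l⁻¹) * ((n : ℝ) + 2 * α - 2)))
        (((gammaMeasure α β).map (fun t : ℝ => t⁻¹)).bind (fun s2 =>
          (gaussianReal μ₀ (l * s2).toNNReal).bind (fun μ =>
            Measure.pi fun _ : Fin n => gaussianReal μ s2.toNNReal))))
      = (β / (((n : ℝ) + l⁻¹) * (α - 1) * Real.sqrt (α - 2)))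
          * Real.sqrt ((n : ℝ) / ((n : ℝ) + 2 * α - 2)) := by
  have hvar := nig_predictive_variance hl hβ hα μ₀ (Nat.one_le_iff_ne_zero.1 hn)
  refine ⟨hvar, ?_⟩
  rw [hvar]
  have hα1 : 0 < α - 1 := by linarith
  have hα2 : 0 < α - 2 := by linarith
  have hN : 0 < (n : ℝ) + 2 * α - 2 := by linarith [(Nat.cast_nonneg n : (0 : ℝ) ≤ n)]
  refine (Real.sqrt_eq_iff_eq_sq (by positivity) (by positivity)).2 ?_
  rw [mul_pow, div_pow, mul_pow, Real.sq_sqrt hα2.le, Real.sq_sqrt (by positivity)]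
  field_simp
end
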